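/- arXiv:1505.02681 — 6 statements merged into one kernel-verified Lean document; each statement's English description precedes it below -/
import Mathlib

section
/- (Lemma 1, Outer-Triangle Distance Pruning, point version) Let S_I be a finite nonempty set of points, S_R a finite nonempty set of points disjoint from S_I, p a natural number with |S_I| ≤ p, q_x and q_y points, and D a real number. If |S_I|·d(q_x,q_y) − ∑_{s∈S_I} d(s,q_x) + (p − |S_I|)·(min_{v∈S_R} d(v,q_y)) ≥ D, then every completion F of S_I satisfies ∑_{v∈F} d(v,q_y) ≥ D. -/
/-- Lemma 1 (Outer-Triangle Distance Pruning, point version). -/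
theorem outer_triangle_pruning_point {X : Type*} [MetricSpace X] [DecidableEq X]
    (S_I S_R : Finset X) (hI : S_I.Nonempty) (hR : S_R.Nonempty)
    (hdisj : Disjoint S_I S_R) (p : ℕ) (hp : S_I.card ≤ p)
    (qx qy : X) (D : ℝ)
    (hprune : (S_I.card : ℝ) * dist qx qy - ∑ s ∈ S_I, dist s qx
        + ((p : ℝ) - S_I.card) * S_R.inf' hR (fun v => dist v qy) ≥ D) :
    ∀ F : Finset X, S_I ⊆ F → F \ S_I ⊆ S_R → F.card = p →
      ∑ v ∈ F, dist v qy ≥ D := by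
  intro F hIF hFR hcard
  have hinner : (S_I.card : ℝ) * dist qx qy - ∑ s ∈ S_I, dist s qx ≤ ∑ s ∈ S_I, dist s qy := by
    rw [← nsmul_eq_mul, ← Finset.sum_const, ← Finset.sum_sub_distrib]
    refine Finset.sum_le_sum fun s _ => ?_
    linarith [dist_triangle_left qx qy s]
  have hcard_sdiff : ((F \ S_I).card : ℝ) = (p : ℝ) - S_I.card := by
    rw [Finset.card_sdiff_of_subset hIF, hcard, Nat.cast_sub hp]
  have houter : ((p : ℝ) - S_I.card) * S_R.inf' hR (fun v => dist v qy)
      ≤ ∑ v ∈ F \ S_I, dist v qy := by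
    rw [← hcard_sdiff, ← nsmul_eq_mul]
    exact Finset.card_nsmul_le_sum _ _ _ fun v hv =>
      Finset.inf'_le (fun v => dist v qy) (hFR hv)
  linarith [Finset.sum_sdiff (f := fun v => dist v qy) hIF]
end

section
/- (Lemma 2, Outer-Triangle Distance Pruning, ball version) Let S_I be a finite nonempty set of points, S_R a finite set of points disjoint from S_I, p a natural number with |S_I| ≤ p, c_x and c_y points, r_y ≥ 0 a real number, m a real number such that m ≤ d(v,q) for every v ∈ S_R and every point q with d(q,c_y) ≤ r_y, and D a real number. If |S_I|·d(c_x,c_y) − ∑_{s∈S_I} d(s,c_x) − |S_I|·r_y + (p − |S_I|)·m ≥ D, then for every point q with d(q,c_y) ≤ r_y and every completion F of S_I, ∑_{v∈F} d(v,q) ≥ D. -/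
/-- Lemma 2 (Outer-Triangle Distance Pruning, ball version). The ball has center `c_y`
and radius `r_y`; `m` is a lower bound on the distance from any remaining candidate in
`S_R` to any point of the ball. -/
theorem outer_triangle_pruning_ball {X : Type*} [MetricSpace X] [DecidableEq X]
    (S_I S_R : Finset X) (hI : S_I.Nonempty)
    (hdisj : Disjoint S_I S_R) (p : ℕ) (hp : S_I.card ≤ p)
    (c_x c_y : X) (r_y : ℝ) (hr : 0 ≤ r_y) (m D : ℝ)
    (hm : ∀ v ∈ S_R, ∀ q : X, dist q c_y ≤ r_y → m ≤ dist v q)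
    (hprune : (S_I.card : ℝ) * dist c_x c_y - ∑ s ∈ S_I, dist s c_x
        - (S_I.card : ℝ) * r_y + ((p : ℝ) - S_I.card) * m ≥ D) :
    ∀ q : X, dist q c_y ≤ r_y →
      ∀ F : Finset X, S_I ⊆ F → F \ S_I ⊆ S_R → F.card = p →
        ∑ v ∈ F, dist v q ≥ D := by
  intro q hq F hIF hFR hF
  have hinner : ∑ s ∈ S_I, (dist c_x c_y - dist s c_x - r_y) ≤ ∑ s ∈ S_I, dist s q := by
    refine Finset.sum_le_sum fun s _ => ?_
    have h := dist_triangle4 c_x s q c_y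
    rw [dist_comm c_x s] at h
    linarith
  have houter : ((F \ S_I).card : ℝ) * m ≤ ∑ v ∈ F \ S_I, dist v q := by
    simpa only [nsmul_eq_mul] using
      Finset.card_nsmul_le_sum (F \ S_I) (dist · q) m fun v hv => hm v (hFR hv) q hq
  rw [Finset.card_sdiff_of_subset hIF, hF, Nat.cast_sub hp] at houter
  simp only [Finset.sum_sub_distrib, Finset.sum_const, nsmul_eq_mul] at hinner
  rw [← Finset.sum_sdiff hIF]
  linarith
end

section
/- (Lemma 3, Inner-Triangle Distance Pruning, point version) Let S_I be a finite set of points with |S_I| ≥ 2, S_R a finite nonempty set of points disjoint from S_I, p a natural number with |S_I| ≤ p, q_x a point, and D a real number. If (1/(|S_I| − 1))·∑_{{u,v}⊆S_I, u≠v} d(u,v) + (p − |S_I|)·(min_{v∈S_R} d(v,q_x)) ≥ D, where the first sum ranges over unordered pairs of distinct points of S_I, then every completion F of S_I satisfies ∑_{v∈F} d(v,q_x) ≥ D. -/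
/-- The sum of all ordered pairwise distances in a finite set is at most `2 * (card - 1)` times
its total distance to any point. -/
theorem sum_offDiag_dist_le {X : Type*} [PseudoMetricSpace X] [DecidableEq X]
    (S : Finset X) (q : X) :
    ∑ z ∈ S.offDiag, dist z.1 z.2 ≤ 2 * ((S.card : ℝ) - 1) * ∑ v ∈ S, dist v q := by
  have hsplit : ∑ z ∈ S ×ˢ S, (dist z.1 q + dist z.2 q)
      = ∑ z ∈ S.diag, (dist z.1 q + dist z.2 q)
        + ∑ z ∈ S.offDiag, (dist z.1 q + dist z.2 q) := by
    rw [← Finset.diag_union_offDiag S, Finset.sum_union (Finset.disjoint_diag_offDiag S)]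
  have hprod : ∑ z ∈ S ×ˢ S, (dist z.1 q + dist z.2 q)
      = 2 * S.card * ∑ v ∈ S, dist v q := by
    simp only [Finset.sum_product, Finset.sum_add_distrib, Finset.sum_const, nsmul_eq_mul,
      ← Finset.mul_sum]
    ring
  have hdiag : ∑ z ∈ S.diag, (dist z.1 q + dist z.2 q) = 2 * ∑ v ∈ S, dist v q := by
    rw [Finset.sum_diag, Finset.sum_add_distrib]
    ring
  calc ∑ z ∈ S.offDiag, dist z.1 z.2
      ≤ ∑ z ∈ S.offDiag, (dist z.1 q + dist z.2 q) :=
        Finset.sum_le_sum fun z _ => dist_triangle_right z.1 z.2 q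
    _ = 2 * ((S.card : ℝ) - 1) * ∑ v ∈ S, dist v q := by linarith

/-- Lemma 3 (Inner-Triangle Distance Pruning, point version). The sum over unordered
pairs of distinct points of `S_I` is expressed as half of the sum over `S_I.offDiag`. -/
theorem inner_triangle_pruning_point {X : Type*} [MetricSpace X] [DecidableEq X]
    (S_I S_R : Finset X) (hI : 2 ≤ S_I.card) (hR : S_R.Nonempty)
    (hdisj : Disjoint S_I S_R) (p : ℕ) (hp : S_I.card ≤ p)
    (qx : X) (D : ℝ)
    (hprune : (1 / ((S_I.card : ℝ) - 1)) * ((1 / 2) * ∑ z ∈ S_I.offDiag, dist z.1 z.2)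
        + ((p : ℝ) - S_I.card) * S_R.inf' hR (fun v => dist v qx) ≥ D) :
    ∀ F : Finset X, S_I ⊆ F → F \ S_I ⊆ S_R → F.card = p →
      ∑ v ∈ F, dist v qx ≥ D := by
  intro F hIF hFR hF
  have hpos : (0 : ℝ) < (S_I.card : ℝ) - 1 := by
    have : (2 : ℝ) ≤ S_I.card := by exact_mod_cast hI
    linarith
  have hinner : (1 / ((S_I.card : ℝ) - 1)) * ((1 / 2) * ∑ z ∈ S_I.offDiag, dist z.1 z.2)
      ≤ ∑ v ∈ S_I, dist v qx := by
    rw [one_div_mul_eq_div, div_le_iff₀ hpos]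
    linarith [sum_offDiag_dist_le S_I qx]
  have hcard : ((F \ S_I).card : ℝ) = (p : ℝ) - S_I.card := by
    rw [Finset.card_sdiff_of_subset hIF, hF, Nat.cast_sub hp]
  have houter : ((p : ℝ) - S_I.card) * S_R.inf' hR (fun v => dist v qx)
      ≤ ∑ v ∈ F \ S_I, dist v qx := by
    rw [← hcard, ← nsmul_eq_mul]
    exact Finset.card_nsmul_le_sum _ _ _ fun v hv => Finset.inf'_le _ (hFR hv)
  rw [← Finset.sum_sdiff hIF]
  linarith
end

section
/- (Lemma 5, Activity Location Distance Pruning) Let S_I be a finite nonempty set of points, S_R a finite set of points disjoint from S_I, p a natural number with |S_I| ≤ p, c a point, r ≥ 0 a real number, m a real number such that m ≤ d(v,q) for every v ∈ S_R and every point q with d(q,c) ≤ r, and D a real number. If ∑_{s∈S_I} (d(s,c) − r) + (p − |S_I|)·m ≥ D, then for every point q with d(q,c) ≤ r and every completion F of S_I, ∑_{v∈F} d(v,q) ≥ D. In particular, ∑_{s∈S_I} (d(s,c) − r) ≤ ∑_{s∈S_I} d(s,q) for every q with d(q,c) ≤ r. -/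
theorem sum_dist_sub_radius_le {X : Type*} [PseudoMetricSpace X] (S : Finset X) {c q : X} {r : ℝ}
    (hq : dist q c ≤ r) : ∑ s ∈ S, (dist s c - r) ≤ ∑ s ∈ S, dist s q :=
  Finset.sum_le_sum fun s _ => by linarith [dist_triangle s q c]

/-- Lemma 5 (Activity Location Distance Pruning). The ball has center `c` and radius `r`;
`MINDIST(s, B) = dist s c - r` is a lower bound on the distance from `s` to any point of
the ball, and `m` is a lower bound on the distance from any remaining candidate in `S_R`
to any point of the ball. -/
theorem activity_location_distance_pruning {X : Type*} [MetricSpace X] [DecidableEq X]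
    (S_I S_R : Finset X) (hI : S_I.Nonempty)
    (hdisj : Disjoint S_I S_R) (p : ℕ) (hp : S_I.card ≤ p)
    (c : X) (r : ℝ) (hr : 0 ≤ r) (m D : ℝ)
    (hm : ∀ v ∈ S_R, ∀ q : X, dist q c ≤ r → m ≤ dist v q)
    (hprune : ∑ s ∈ S_I, (dist s c - r) + ((p : ℝ) - S_I.card) * m ≥ D) :
    (∀ q : X, dist q c ≤ r →
      ∀ F : Finset X, S_I ⊆ F → F \ S_I ⊆ S_R → F.card = p →
        ∑ v ∈ F, dist v q ≥ D) ∧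
    (∀ q : X, dist q c ≤ r →
      ∑ s ∈ S_I, (dist s c - r) ≤ ∑ s ∈ S_I, dist s q) := by
  refine ⟨fun q hq F hIF hFR hF => ?_, fun q hq => sum_dist_sub_radius_le S_I hq⟩
  have hrest : ((F \ S_I).card : ℝ) * m ≤ ∑ v ∈ F \ S_I, dist v q := by
    simpa using Finset.card_nsmul_le_sum (F \ S_I) (fun v => dist v q) m
      fun v hv => hm v (hFR hv) q hq
  rw [Finset.cast_card_sdiff hIF, hF] at hrest
  linarith [Finset.sum_sdiff (f := fun v => dist v q) hIF, sum_dist_sub_radius_le S_I hq]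
end

section
/- (Familiarity Pruning, Eq. (5)) Let G be a simple graph, S_I and S_R disjoint finite sets of vertices, and p, k natural numbers with |S_I| ≤ p. If ∑_{v∈S_R} |N(v) ∩ S_R| < (p − |S_I|)·(p − |S_I| − k − 1), then for every set F = S_I ∪ T with T ⊆ S_R and |F| = p, there exists a vertex u ∈ F with unfamiliar(u,F) > k; hence no completion of S_I from S_R satisfies the familiarity constraint with parameter k. -/
/-- Familiarity Pruning, Eq. (5): if the total number of neighbours inside `S_R` is too
small, then no completion `F = S_I ∪ T` (with `T ⊆ S_R` and `|F| = p`) satisfies the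
familiarity constraint with parameter `k`; some member `u` of `F` has more than `k`
non-neighbours among the other members of `F`. -/
theorem familiarity_pruning_eq5 {V : Type*} [Fintype V] [DecidableEq V]
    (G : SimpleGraph V) [DecidableRel G.Adj]
    (S_I S_R : Finset V) (hdisj : Disjoint S_I S_R)
    (p k : ℕ) (hp : S_I.card ≤ p)
    (h : ∑ v ∈ S_R, (G.neighborFinset v ∩ S_R).card
        < (p - S_I.card) * (p - S_I.card - k - 1)) :
    ∀ T : Finset V, T ⊆ S_R → (S_I ∪ T).card = p →
      ∃ u ∈ S_I ∪ T, ((S_I ∪ T) \ insert u (G.neighborFinset u)).card > k := by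
  intro T hT hcard
  by_contra! hF
  have hTcard : T.card = p - S_I.card := by
    rw [Finset.card_union_of_disjoint (hdisj.mono_right hT)] at hcard
    omega
  have hdeg : ∀ u ∈ T, p - S_I.card - k - 1 ≤ (G.neighborFinset u ∩ S_R).card := by
    intro u hu
    have hcover : T ⊆ ((S_I ∪ T) \ insert u (G.neighborFinset u)) ∪
        insert u (G.neighborFinset u ∩ S_R) := by
      intro x hx
      have := hT hx
      simp only [Finset.mem_union, Finset.mem_sdiff, Finset.mem_insert, Finset.mem_inter]
      tauto
    have hle := (Finset.card_le_card hcover).trans (Finset.card_union_le _ _)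
    have hinsert := Finset.card_insert_le u (G.neighborFinset u ∩ S_R)
    have hunfamiliar := hF u (Finset.mem_union_right _ hu)
    omega
  refine h.not_ge ?_
  calc (p - S_I.card) * (p - S_I.card - k - 1)
      = T.card • (p - S_I.card - k - 1) := by rw [hTcard, smul_eq_mul]
    _ ≤ ∑ v ∈ T, (G.neighborFinset v ∩ S_R).card := Finset.card_nsmul_le_sum _ _ _ hdeg
    _ ≤ ∑ v ∈ S_R, (G.neighborFinset v ∩ S_R).card := Finset.sum_le_sum_of_subset hT
end

section
/- (First part of Theorem 'node_identity': the core of a threshold graph is upward closed in the degree partition) Let G be a simple graph on a finite vertex set V, let m be a natural number, and let ι : V → {0,1,...,m} be a labeling such that two distinct vertices u, v are adjacent in G if and only if ι(u) + ι(v) > m. Let c be a natural number, and let W ⊆ V be maximal with the property that every vertex of W has at least c neighbors in W (i.e., W has the property, and every subset of V with the property is contained in W). Then W is upward closed with respect to ι: if u ∈ W and ι(u') ≥ ι(u), then u' ∈ W. Consequently, if W is nonempty and ĵ = min{ι(v) : v ∈ W}, then W = {v ∈ V : ι(v) ≥ ĵ}. -/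
/-- First part of Theorem `node_identity`: in a threshold graph (distinct vertices are
adjacent iff the sum of their labels exceeds `m`), the maximal set `W` in which every
vertex has at least `c` neighbors (the maximal `c`-core) is upward closed with respect to
the labeling `ι`; consequently, if `W` is nonempty and `ĵ` is the minimum label occurring
in `W`, then `W` consists exactly of the vertices with label at least `ĵ`. -/
theorem threshold_core_upward_closed {V : Type*} [Fintype V] [DecidableEq V]
    (G : SimpleGraph V) [DecidableRel G.Adj]
    (m : ℕ) (ι : V → ℕ) (hι : ∀ v, ι v ≤ m)
    (hadj : ∀ u v : V, u ≠ v → (G.Adj u v ↔ m < ι u + ι v))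
    (c : ℕ) (W : Finset V)
    (hWprop : ∀ u ∈ W, c ≤ (G.neighborFinset u ∩ W).card)
    (hWmax : ∀ U : Finset V, (∀ u ∈ U, c ≤ (G.neighborFinset u ∩ U).card) → U ⊆ W) :
    (∀ u ∈ W, ∀ u' : V, ι u ≤ ι u' → u' ∈ W) ∧
    (∀ hW : W.Nonempty, W = Finset.univ.filter fun v => W.inf' hW ι ≤ ι v) := by
  have hup : ∀ u ∈ W, ∀ u' : V, ι u ≤ ι u' → u' ∈ W := by
    intro u hu u' hle
    by_contra hu'
    refine hu' (hWmax (insert u' W) ?_ (Finset.mem_insert_self u' W))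
    intro v hv
    rcases Finset.mem_insert.mp hv with rfl | hv
    · refine (hWprop u hu).trans (Finset.card_le_card fun w hw => ?_)
      simp only [Finset.mem_inter, SimpleGraph.mem_neighborFinset] at hw ⊢
      have hne : v ≠ w := fun h => hu' (h ▸ hw.2)
      have hsum := (hadj u w hw.1.ne).mp hw.1
      exact ⟨(hadj v w hne).mpr (by omega), Finset.mem_insert_of_mem hw.2⟩
    · exact (hWprop v hv).trans (Finset.card_le_card
        (Finset.inter_subset_inter_left (Finset.subset_insert u' W)))
  refine ⟨hup, fun hW => ?_⟩
  ext v
  simp only [Finset.mem_filter, Finset.mem_univ, true_and]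
  refine ⟨fun hv => Finset.inf'_le ι hv, fun hv => ?_⟩
  obtain ⟨u, hu, hmin⟩ := Finset.exists_mem_eq_inf' hW ι
  exact hup u hu v (hmin ▸ hv)
end
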